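/- There exists a distance d on the Heisenberg group ℍ such that: (1) d(p,q) ≤ d_b(p,q) for all p,q ∈ ℍ; (2) the metric space (ℍ, d) is Ahlfors 4-regular; (3) for every subset A ⊆ ℍ with H⁴_{d_b}(A) > 0, the distances d and d_b are not biLipschitz equivalent on A, i.e. there is no constant L ≥ 1 with L⁻¹·d_b(x,y) ≤ d(x,y) ≤ L·d_b(x,y) for all x,y ∈ A. -/

import Mathlib

open scoped ENNReal

namespace Heis

/-- The underlying set of the Heisenberg group: `ℝ³`. -/
abbrev H : Type := ℝ × ℝ × ℝ

/-- Heisenberg group multiplication. -/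
noncomputable def Hmul (p q : H) : H :=
  (p.1 + q.1, p.2.1 + q.2.1, p.2.2 + q.2.2 + (p.1 * q.2.1 - p.2.1 * q.1) / 2)

/-- Heisenberg group inverse. -/
def Hinv (p : H) : H := (-p.1, -p.2.1, -p.2.2)

/-- The box norm `‖p‖ = max {|x|, |y|, √|z|}`. -/
noncomputable def boxNorm (p : H) : ℝ :=
  max |p.1| (max |p.2.1| (Real.sqrt |p.2.2|))

/-- The box distance `d_b(p,q) = ‖p⁻¹·q‖`. -/
noncomputable def dbox (p q : H) : ℝ := boxNorm (Hmul (Hinv p) q)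

/-- The dilations `δ_λ(x,y,z) = (λx, λy, λ²z)`. -/
noncomputable def dil (lam : ℝ) (p : H) : H := (lam * p.1, lam * p.2.1, lam ^ 2 * p.2.2)

/-- `d` is a distance (metric) on `X`. -/
def IsDistance {X : Type*} (d : X → X → ℝ) : Prop :=
  (∀ x y, d x y = d y x) ∧ (∀ x, d x x = 0) ∧
  (∀ x y, d x y = 0 → x = y) ∧ (∀ x y z, d x z ≤ d x y + d y z)

/-- The open ball of the distance function `d`. -/
def ballOf {X : Type*} (d : X → X → ℝ) (x : X) (r : ℝ) : Set X := {y | d x y < r}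

/-- The (extended) diameter of a set with respect to a distance function `d`. -/
noncomputable def ediamOf {X : Type*} (d : X → X → ℝ) (E : Set X) : ℝ≥0∞ :=
  ⨆ (x ∈ E) (y ∈ E), ENNReal.ofReal (d x y)

/-- The Hausdorff `Q`-measure of `A` with respect to the distance function `d`:
`H^Q_d(A) = lim_{ε→0} inf { Σᵢ (diam Eᵢ)^Q : A ⊆ ⋃ᵢ Eᵢ, diam Eᵢ ≤ ε }`. -/
noncomputable def hausdorffOf {X : Type*} (d : X → X → ℝ) (Q : ℝ) (A : Set X) : ℝ≥0∞ :=
  ⨆ (ε : ℝ≥0∞) (_ : 0 < ε),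
    ⨅ (E : ℕ → Set X) (_ : A ⊆ ⋃ n, E n) (_ : ∀ n, ediamOf d (E n) ≤ ε),
      ∑' n, ediamOf d (E n) ^ Q

/-- `(X, d)` is Ahlfors `Q`-regular: there is `C ≥ 1` with
`C⁻¹ r^Q ≤ H^Q_d(B_d(x,r)) ≤ C r^Q` for all `x` and `0 < r < diam X`. -/
def AhlforsRegularOf {X : Type*} (d : X → X → ℝ) (Q : ℝ) : Prop :=
  ∃ C : ℝ, 1 ≤ C ∧ ∀ (x : X) (r : ℝ), 0 < r → ENNReal.ofReal r < ediamOf d Set.univ →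
    ENNReal.ofReal (C⁻¹ * r ^ Q) ≤ hausdorffOf d Q (ballOf d x r) ∧
    hausdorffOf d Q (ballOf d x r) ≤ ENNReal.ofReal (C * r ^ Q)

/-- The distances `d` and `ρ` are biLipschitz equivalent on the set `A`. -/
def BiLipOn {X : Type*} (d ρ : X → X → ℝ) (A : Set X) : Prop :=
  ∃ L : ℝ, 1 ≤ L ∧ ∀ x ∈ A, ∀ y ∈ A, L⁻¹ * ρ x y ≤ d x y ∧ d x y ≤ L * ρ x y



/-- The vertical component of `p⁻¹ · q`. -/
noncomputable def vgap (p q : H) : ℝ := q.2.2 - p.2.2 + (p.2.1 * q.1 - p.1 * q.2.1) / 2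

lemma dbox_eq (p q : H) :
    dbox p q = max |q.1 - p.1| (max |q.2.1 - p.2.1| (Real.sqrt |vgap p q|)) := by
  simp only [dbox, boxNorm, Hmul, Hinv, vgap]
  congr 2 <;> ring_nf

lemma dbox_nonneg (p q : H) : 0 ≤ dbox p q := by
  rw [dbox_eq]; positivity

lemma dbox_le_iff {p q : H} {r : ℝ} (hr : 0 ≤ r) :
    dbox p q ≤ r ↔ |q.1 - p.1| ≤ r ∧ |q.2.1 - p.2.1| ≤ r ∧ |vgap p q| ≤ r ^ 2 := by
  rw [dbox_eq, max_le_iff, max_le_iff, Real.sqrt_le_left hr]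

lemma dbox_comm (p q : H) : dbox p q = dbox q p := by
  rw [dbox_eq, dbox_eq, abs_sub_comm q.1, abs_sub_comm q.2.1, ← abs_neg (vgap p q)]
  congr 4
  simp only [vgap]; ring

lemma dbox_self (p : H) : dbox p p = 0 := by
  rw [dbox_eq]
  have : vgap p p = 0 := by simp only [vgap]; ring
  simp [this]

lemma eq_of_dbox_eq_zero {p q : H} (h : dbox p q = 0) : p = q := by
  obtain ⟨h1, h2, h3⟩ := (dbox_le_iff le_rfl).1 h.le
  have e1 : q.1 = p.1 := by linarith [abs_nonpos_iff.1 h1]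
  have e2 : q.2.1 = p.2.1 := by linarith [abs_nonpos_iff.1 h2]
  have e3 : vgap p q = 0 := by simpa using h3
  have e4 : q.2.2 = p.2.2 := by
    simp only [vgap, e1, e2] at e3; linarith
  exact (Prod.ext e1 (Prod.ext e2 e4)).symm

lemma dbox_triangle (p q t : H) : dbox p t ≤ dbox p q + dbox q t := by
  have hr := dbox_nonneg p q
  have hs := dbox_nonneg q t
  set r := dbox p q with hr'
  set s := dbox q t with hs'
  obtain ⟨a1, a2, a3⟩ := (dbox_le_iff hr).1 hr'.ge
  obtain ⟨b1, b2, b3⟩ := (dbox_le_iff hs).1 hs'.ge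
  refine (dbox_le_iff (by positivity)).2 ⟨?_, ?_, ?_⟩
  · calc |t.1 - p.1| = |(q.1 - p.1) + (t.1 - q.1)| := by ring_nf
      _ ≤ _ := (abs_add_le _ _).trans (add_le_add a1 b1)
  · calc |t.2.1 - p.2.1| = |(q.2.1 - p.2.1) + (t.2.1 - q.2.1)| := by ring_nf
      _ ≤ _ := (abs_add_le _ _).trans (add_le_add a2 b2)
  · have e : vgap p t = vgap p q + vgap q t +
        ((q.1 - p.1) * (t.2.1 - q.2.1) - (q.2.1 - p.2.1) * (t.1 - q.1)) / 2 := by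
      simp only [vgap]; ring
    have c1 : |(q.1 - p.1) * (t.2.1 - q.2.1)| ≤ r * s := by
      rw [abs_mul]; exact mul_le_mul a1 b2 (abs_nonneg _) hr
    have c2 : |(q.2.1 - p.2.1) * (t.1 - q.1)| ≤ r * s := by
      rw [abs_mul]; exact mul_le_mul a2 b1 (abs_nonneg _) hr
    rw [e]
    rw [abs_le] at *
    constructor <;> nlinarith [mul_nonneg hr hs]

/-- Vertical translation by `t`. -/
def vert (p : H) (t : ℝ) : H := (p.1, p.2.1, p.2.2 + t)

lemma dbox_vert_vert (p q : H) (t : ℝ) : dbox (vert p t) (vert q t) = dbox p q := by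
  have : vgap (vert p t) (vert q t) = vgap p q := by simp only [vgap, vert]; ring
  rw [dbox_eq, dbox_eq, this]; rfl

lemma dbox_vert_self (p : H) (t : ℝ) : dbox p (vert p t) = Real.sqrt |t| := by
  have : vgap p (vert p t) = t := by simp only [vgap, vert]; ring
  rw [dbox_eq, this]; simp [vert]

lemma continuous_dbox_right (p : H) : Continuous (dbox p) := by
  have : dbox p = fun q => max |q.1 - p.1| (max |q.2.1 - p.2.1| (Real.sqrt |vgap p q|)) :=
    funext (dbox_eq p)
  rw [this]
  unfold vgap
  fun_prop

lemma isOpen_iff_dbox (s : Set H) :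
    IsOpen s ↔ ∀ p ∈ s, ∃ ε > 0, ∀ q, dbox p q < ε → q ∈ s := by
  constructor
  · intro hs p hp
    have hc : Continuous (fun q : H => Hmul p q) := by unfold Hmul; fun_prop
    have h0 : (0 : H) ∈ (fun q : H => Hmul p q) ⁻¹' s := by
      simpa [Hmul] using hp
    obtain ⟨δ, hδ, hsub⟩ := Metric.isOpen_iff.1 (hs.preimage hc) 0 h0
    refine ⟨min δ 1, by positivity, fun q hq => ?_⟩
    have hq1 : dbox p q < 1 := hq.trans_le (min_le_right _ _)
    have hqδ : dbox p q < δ := hq.trans_le (min_le_left _ _)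
    obtain ⟨h1, h2, h3⟩ := (dbox_le_iff (dbox_nonneg p q)).1 le_rfl
    have h4 : dbox p q ^ 2 ≤ dbox p q := by nlinarith [dbox_nonneg p q]
    have hmem : ((q.1 - p.1, q.2.1 - p.2.1, vgap p q) : H) ∈ Metric.ball (0 : H) δ := by
      rw [Metric.mem_ball, dist_zero_right, Prod.norm_def, Prod.norm_def]
      simp only [Real.norm_eq_abs]
      exact max_lt (by linarith) (max_lt (by linarith) (by linarith))
    have := hsub hmem
    have e : Hmul p (q.1 - p.1, q.2.1 - p.2.1, vgap p q) = q := by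
      refine Prod.ext ?_ (Prod.ext ?_ ?_) <;> simp only [Hmul, vgap] <;> ring
    simpa only [Set.mem_preimage, e] using this
  · intro h
    rw [isOpen_iff_mem_nhds]
    intro p hp
    obtain ⟨ε, hε, hs⟩ := h p hp
    have : {q | dbox p q < ε} ∈ nhds p :=
      ((isOpen_Iio (a := ε)).preimage (continuous_dbox_right p)).mem_nhds
        (by simpa [dbox_self] using hε)
    exact Filter.mem_of_superset this hs

open MeasureTheory

/-- `H` as a metric space with the box distance; its topology is the Euclidean one. -/
def BoxSpace : Type := H

namespace BoxSpace

noncomputable instance : MetricSpace BoxSpace :=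
  MetricSpace.ofDistTopology (α := H) dbox dbox_self dbox_comm dbox_triangle isOpen_iff_dbox
    fun _ _ => eq_of_dbox_eq_zero

lemma dist_eq (p q : BoxSpace) : dist p q = dbox p q := rfl

lemma mem_closedBall {x y : BoxSpace} {r : ℝ} : y ∈ Metric.closedBall x r ↔ dbox x y ≤ r :=
  Metric.mem_closedBall'

noncomputable instance : MeasureSpace BoxSpace := inferInstanceAs (MeasureSpace H)

instance : SecondCountableTopology BoxSpace := inferInstanceAs (SecondCountableTopology H)

instance : BorelSpace BoxSpace := inferInstanceAs (BorelSpace H)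

instance : IsLocallyFiniteMeasure (volume : Measure BoxSpace) :=
  inferInstanceAs (IsLocallyFiniteMeasure (volume : Measure H))

instance : (volume : Measure BoxSpace).OuterRegular :=
  inferInstanceAs (volume : Measure H).OuterRegular

end BoxSpace

lemma measurePreserving_Hmul (p : H) :
    MeasurePreserving (Hmul p) (volume : Measure H) (volume : Measure H) := by
  have hin : ∀ x : ℝ, MeasurePreserving
      (fun w : ℝ × ℝ => (p.2.1 + w.1, p.2.2 + w.2 + (p.1 * w.1 - p.2.1 * x) / 2))
      (volume : Measure (ℝ × ℝ)) volume := by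
    intro x
    refine (measurePreserving_add_left (volume : Measure ℝ) p.2.1).skew_product
      (g := fun y z => p.2.2 + z + (p.1 * y - p.2.1 * x) / 2)
      (by unfold Function.uncurry; fun_prop) (Filter.Eventually.of_forall fun y => ?_)
    have e : (fun z => p.2.2 + z + (p.1 * y - p.2.1 * x) / 2) =
        fun z => p.2.2 + (p.1 * y - p.2.1 * x) / 2 + z := by
      ext z; ring
    rw [e]
    exact (measurePreserving_add_left (volume : Measure ℝ) _).map_eq
  exact (measurePreserving_add_left (volume : Measure ℝ) p.1).skew_product
    (g := fun x (w : ℝ × ℝ) => (p.2.1 + w.1, p.2.2 + w.2 + (p.1 * w.1 - p.2.1 * x) / 2))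
    (by unfold Function.uncurry; fun_prop)
    (Filter.Eventually.of_forall fun x => (hin x).map_eq)

lemma volume_dbox_closedBall (p : H) {r : ℝ} (hr : 0 ≤ r) :
    volume {q : H | dbox p q ≤ r} = ENNReal.ofReal (8 * r ^ 4) := by
  have hm : MeasurableSet {q : H | dbox p q ≤ r} :=
    (isClosed_Iic.preimage (continuous_dbox_right p)).measurableSet
  rw [← (measurePreserving_Hmul p).measure_preimage hm.nullMeasurableSet]
  have : Hmul p ⁻¹' {q : H | dbox p q ≤ r} =
      Set.Icc (-r) r ×ˢ (Set.Icc (-r) r ×ˢ Set.Icc (-r ^ 2) (r ^ 2)) := by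
    ext q
    have e : vgap p (Hmul p q) = q.2.2 := by simp only [vgap, Hmul]; ring
    simp only [Set.mem_preimage, Set.mem_ofPred_eq, dbox_le_iff hr, e, Set.mem_prod, Set.mem_Icc]
    simp [Hmul, abs_le]
  rw [this, Measure.volume_eq_prod, Measure.prod_prod, Measure.volume_eq_prod, Measure.prod_prod]
  simp only [Real.volume_Icc]
  rw [← ENNReal.ofReal_mul (by linarith), ← ENNReal.ofReal_mul (by linarith)]
  congr 1; ring

lemma BoxSpace.volume_closedBall (p : BoxSpace) {r : ℝ} (hr : 0 ≤ r) :
    volume (Metric.closedBall p r) = ENNReal.ofReal (8 * r ^ 4) := by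
  have : Metric.closedBall p r = {q : H | dbox p q ≤ r} := Set.ext fun _ => mem_closedBall
  rw [this]
  exact volume_dbox_closedBall p hr

instance : IsUnifLocDoublingMeasure (volume : Measure BoxSpace) where
  exists_measure_closedBall_le_mul'' := by
    refine ⟨16, Filter.eventually_of_mem self_mem_nhdsWithin fun r hr p => ?_⟩
    have hr : 0 < r := hr
    rw [BoxSpace.volume_closedBall p (by linarith), BoxSpace.volume_closedBall p hr.le]
    refine le_of_eq ?_
    have : ((16 : NNReal) : ℝ≥0∞) = ENNReal.ofReal 16 := by norm_num
    rw [this, ← ENNReal.ofReal_mul (by norm_num)]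
    congr 1; ring

section Hausdorff

variable {X : Type*}

lemma ediamOf_le {d : X → X → ℝ} {E : Set X} {D : ℝ} (h : ∀ x ∈ E, ∀ y ∈ E, d x y ≤ D) :
    ediamOf d E ≤ ENNReal.ofReal D :=
  iSup₂_le fun x hx => iSup₂_le fun y hy => ENNReal.ofReal_le_ofReal (h x hx y hy)

lemma ofReal_le_ediamOf (d : X → X → ℝ) {E : Set X} {x y : X} (hx : x ∈ E) (hy : y ∈ E) :
    ENNReal.ofReal (d x y) ≤ ediamOf d E :=
  le_iSup₂_of_le x hx (le_iSup₂_of_le y hy le_rfl)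

lemma ediamOf_mono {d ρ : X → X → ℝ} (h : ∀ x y, d x y ≤ ρ x y) (E : Set X) :
    ediamOf d E ≤ ediamOf ρ E :=
  iSup₂_mono fun _ _ => iSup₂_mono fun _ _ => ENNReal.ofReal_le_ofReal (h _ _)

lemma ediamOf_empty (d : X → X → ℝ) : ediamOf d ∅ = 0 := by
  simp [ediamOf]

lemma hausdorffOf_mono_dist {d ρ : X → X → ℝ} (h : ∀ x y, d x y ≤ ρ x y) {Q : ℝ} (hQ : 0 ≤ Q)
    (A : Set X) : hausdorffOf d Q A ≤ hausdorffOf ρ Q A :=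
  iSup₂_mono fun _ _ => le_iInf₂ fun E hE => le_iInf fun hε =>
    iInf₂_le_of_le E hE <| iInf_le_of_le (fun n => (ediamOf_mono h _).trans (hε n)) <|
      ENNReal.tsum_le_tsum fun _ => ENNReal.rpow_le_rpow (ediamOf_mono h _) hQ

lemma iInf_cover_le_tsum {ι : Type*} [Countable ι] (d : X → X → ℝ) {Q : ℝ} (hQ : 0 < Q)
    {A : Set X} {ε : ℝ≥0∞} (F : ι → Set X) (hA : A ⊆ ⋃ i, F i) (hF : ∀ i, ediamOf d (F i) ≤ ε) :
    ⨅ (E : ℕ → Set X) (_ : A ⊆ ⋃ n, E n) (_ : ∀ n, ediamOf d (E n) ≤ ε),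
      ∑' n, ediamOf d (E n) ^ Q ≤ ∑' i, ediamOf d (F i) ^ Q := by
  have := Encodable.ofCountable ι
  refine iInf₂_le_of_le (fun n => ⋃ i ∈ Encodable.decode₂ ι n, F i)
    (by rwa [Encodable.iUnion_decode₂]) (iInf_le_of_le (fun n => ?_) ?_)
  · exact Encodable.iUnion_decode₂_cases (C := fun E => ediamOf d E ≤ ε)
      (by simp [ediamOf_empty]) hF
  · exact (tsum_iUnion_decode₂ (fun E => ediamOf d E ^ Q) (by simp [ediamOf_empty, hQ]) F).le

end Hausdorff

lemma hausdorffOf_dbox_le_volume (A : Set H) :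
    hausdorffOf dbox 4 A ≤ 1250 * volume A := by
  refine iSup₂_le fun ε hε => ?_
  rcases eq_or_ne (volume A) ⊤ with hA | hA
  · rw [hA, ENNReal.mul_top (by norm_num)]; exact le_top
  obtain ⟨δ, hδ, hδε⟩ : ∃ δ : ℝ, 0 < δ ∧ ENNReal.ofReal (10 * δ) ≤ ε := by
    obtain ⟨η, h0, h1⟩ := ENNReal.lt_iff_exists_nnreal_btwn.1 hε
    have h0 : 0 < (η : ℝ) := by exact_mod_cast h0
    refine ⟨η / 10, by positivity, ?_⟩
    rw [mul_div_cancel₀ _ (by norm_num), ENNReal.ofReal_coe_nnreal]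
    exact h1.le
  rw [mul_comm, ← ENNReal.div_le_iff_le_mul (Or.inl (by norm_num)) (Or.inl (by norm_num))]
  refine le_of_forall_gt fun v hv => ?_
  obtain ⟨U, hAU, hU, hUv⟩ := Set.exists_isOpen_lt_of_lt (α := BoxSpace)
    (μ := (volume : Measure BoxSpace)) A v hv
  refine lt_of_le_of_lt ?_ hUv
  rw [ENNReal.div_le_iff_le_mul (Or.inl (by norm_num)) (Or.inl (by norm_num))]
  have hball : ∀ p : BoxSpace, ∃ r : ℝ, 0 < r ∧ r ≤ δ ∧ (p ∈ U → Metric.closedBall p r ⊆ U) := by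
    intro p
    by_cases hp : p ∈ U
    · obtain ⟨r, hr, hrU⟩ := Metric.nhds_basis_closedBall.mem_iff.1 (hU.mem_nhds hp)
      exact ⟨min r δ, by positivity, min_le_right _ _,
        fun _ => (Metric.closedBall_subset_closedBall (min_le_left _ _)).trans hrU⟩
    · exact ⟨δ, hδ, le_rfl, fun h => (hp h).elim⟩
  choose r hr0 hrδ hrU using hball
  obtain ⟨u, huU, hdisj, hcov⟩ := Vitali.exists_disjoint_subfamily_covering_enlargement_closedBall
    U id r δ (fun p _ => hrδ p) 5 (by norm_num)
  have hcount : u.Countable := hdisj.countable_of_nonempty_interior fun p _ =>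
    ⟨p, Metric.ball_subset_interior_closedBall (Metric.mem_ball_self (hr0 p))⟩
  have : Countable u := hcount.to_subtype
  have hdiam : ∀ p : BoxSpace,
      ediamOf (X := BoxSpace) dbox (Metric.closedBall p (5 * r p)) ≤ ENNReal.ofReal (10 * r p) := by
    refine fun p => ediamOf_le fun x hx y hy => ?_
    have h1 := Metric.mem_closedBall.1 hx
    have h2 := Metric.mem_closedBall'.1 hy
    have h3 := dist_triangle (α := BoxSpace) x p y
    rw [BoxSpace.dist_eq x y] at h3
    linarith
  calc _ ≤ ∑' p : u, ediamOf (X := BoxSpace) dbox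
          (Metric.closedBall (p : BoxSpace) (5 * r p)) ^ (4 : ℝ) := by
        refine iInf_cover_le_tsum (X := BoxSpace) dbox (by norm_num) _ ?_ ?_
        · intro p hp
          obtain ⟨q, hq, hpq⟩ := hcov p (hAU hp)
          exact Set.mem_iUnion.2 ⟨⟨q, hq⟩, hpq (Metric.mem_closedBall_self (hr0 p).le)⟩
        · refine fun p => (hdiam p).trans (le_trans (ENNReal.ofReal_le_ofReal ?_) hδε)
          linarith [hrδ p]
    _ ≤ ∑' p : u, volume (Metric.closedBall (p : BoxSpace) (r p)) * 1250 := by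
        refine ENNReal.tsum_le_tsum fun p => ?_
        refine (ENNReal.rpow_le_rpow (hdiam p) (by norm_num)).trans (le_of_eq ?_)
        have hp := hr0 p
        rw [BoxSpace.volume_closedBall _ hp.le, ENNReal.rpow_ofNat,
          ← ENNReal.ofReal_pow (by positivity), ← ENNReal.ofReal_ofNat 1250,
          ← ENNReal.ofReal_mul (by positivity)]
        congr 1; ring
    _ = volume (⋃ p ∈ u, Metric.closedBall p (r p)) * 1250 := by
        rw [ENNReal.tsum_mul_right, measure_biUnion (f := fun p => Metric.closedBall p (r p))
          hcount hdisj fun p _ => Metric.isClosed_closedBall.measurableSet]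
    _ ≤ volume U * 1250 := by
        gcongr
        exact Set.iUnion₂_subset fun p hp => hrU p (huU hp)

lemma volume_le_hausdorffOf {d : H → H → ℝ} {C : ℝ} (hC : 0 < C)
    (h : ∀ x D, 0 ≤ D → volume {y | d x y ≤ D} ≤ ENNReal.ofReal (C * D ^ 4)) (A : Set H) :
    volume A ≤ ENNReal.ofReal C * hausdorffOf d 4 A := by
  have hE : ∀ E : Set H, ediamOf d E ≤ 1 → volume E ≤ ENNReal.ofReal C * ediamOf d E ^ (4 : ℝ) := by
    intro E hE
    rcases E.eq_empty_or_nonempty with rfl | ⟨x, hx⟩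
    · simp
    have hfin : ediamOf d E ≠ ⊤ := ne_top_of_le_ne_top ENNReal.one_ne_top hE
    have hsub : E ⊆ {y | d x y ≤ (ediamOf d E).toReal} := fun y hy =>
      (ENNReal.ofReal_le_iff_le_toReal hfin).1 (ofReal_le_ediamOf d hx hy)
    refine (measure_mono hsub).trans ((h x _ ENNReal.toReal_nonneg).trans_eq ?_)
    rw [ENNReal.ofReal_mul hC.le, ENNReal.ofReal_pow ENNReal.toReal_nonneg,
      ENNReal.ofReal_toReal hfin, ENNReal.rpow_ofNat]
  have h1 : ENNReal.ofReal C * (⨅ (E : ℕ → Set H) (_ : A ⊆ ⋃ n, E n)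
      (_ : ∀ n, ediamOf d (E n) ≤ 1), ∑' n, ediamOf d (E n) ^ (4 : ℝ)) ≤
      ENNReal.ofReal C * hausdorffOf d 4 A := by
    gcongr
    exact le_iSup₂_of_le (f := fun (ε : ℝ≥0∞) (_ : 0 < ε) => ⨅ (E : ℕ → Set H)
      (_ : A ⊆ ⋃ n, E n) (_ : ∀ n, ediamOf d (E n) ≤ ε), ∑' n, ediamOf d (E n) ^ (4 : ℝ))
      1 one_pos le_rfl
  refine le_trans ?_ h1
  simp only [ENNReal.mul_iInf_of_ne (ENNReal.ofReal_pos.2 hC).ne' ENNReal.ofReal_ne_top]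
  refine le_iInf₂ fun E hA => le_iInf fun hd => ?_
  calc volume A ≤ ∑' n, volume (E n) := (measure_mono hA).trans (measure_iUnion_le _)
    _ ≤ ∑' n, ENNReal.ofReal C * ediamOf d (E n) ^ (4 : ℝ) :=
        ENNReal.tsum_le_tsum fun n => hE _ (hd n)
    _ = _ := ENNReal.tsum_mul_left

section Potential

variable {X ι : Type*} [PseudoMetricSpace X] (lo hi : ι → X) (x : X)

/-- The distance from `x` to the pair `{lo i, hi i}`. -/
noncomputable def pairDist (i : ι) : ℝ := min (dist x (lo i)) (dist x (hi i))

/-- A `2`-Lipschitz function vanishing at `x` and, for well separated pairs, taking the same value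
at both points of each pair `{lo i, hi i}`. -/
noncomputable def potential (y : X) : ℝ :=
  min (2 * dist x y) (⨅ i, (pairDist lo hi x i + 2 * pairDist lo hi y i))

lemma pairDist_nonneg (i : ι) : 0 ≤ pairDist lo hi x i := le_min dist_nonneg dist_nonneg

lemma pairDist_le_add (y z : X) (i : ι) :
    pairDist lo hi y i ≤ pairDist lo hi z i + dist y z := by
  rw [pairDist, pairDist, ← min_add_add_right]
  exact min_le_min (by linarith [dist_triangle y z (lo i)]) (by linarith [dist_triangle y z (hi i)])

lemma potential_bddBelow (y : X) :
    BddBelow (Set.range fun i => pairDist lo hi x i + 2 * pairDist lo hi y i) :=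
  ⟨0, by rintro _ ⟨i, rfl⟩; linarith [pairDist_nonneg lo hi x i, pairDist_nonneg lo hi y i]⟩

variable {lo hi x}

lemma exists_dist_lt_of_pairDist_lt {i : ι} {R : ℝ} (h : pairDist lo hi x i < R) :
    ∃ p, (p = lo i ∨ p = hi i) ∧ dist x p < R :=
  (min_lt_iff.1 h).elim (fun h => ⟨_, Or.inl rfl, h⟩) fun h => ⟨_, Or.inr rfl, h⟩

lemma exists_dist_eq_pairDist (i : ι) :
    ∃ p, (p = lo i ∨ p = hi i) ∧ dist x p = pairDist lo hi x i :=
  (min_choice (dist x (lo i)) (dist x (hi i))).elim (fun h => ⟨_, Or.inl rfl, h.symm⟩)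
    fun h => ⟨_, Or.inr rfl, h.symm⟩

lemma dist_le_of_mem_pair {r : ℝ} (hr : 0 ≤ r) {i : ι} (hpair : dist (lo i) (hi i) ≤ r) {p q : X}
    (hp : p = lo i ∨ p = hi i) (hq : q = lo i ∨ q = hi i) : dist p q ≤ r := by
  rcases hp with rfl | rfl <;> rcases hq with rfl | rfl
  exacts [(dist_self _).trans_le hr, hpair, (dist_comm _ _).trans_le hpair,
    (dist_self _).trans_le hr]

variable [Nonempty ι]

lemma potential_nonneg (y : X) : 0 ≤ potential lo hi x y :=
  le_min (by positivity) (le_ciInf fun i => by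
    linarith [pairDist_nonneg lo hi x i, pairDist_nonneg lo hi y i])

lemma potential_self : potential lo hi x x = 0 :=
  le_antisymm ((min_le_left _ _).trans (by simp)) (potential_nonneg x)

lemma potential_le_add (y z : X) :
    potential lo hi x y ≤ potential lo hi x z + 2 * dist y z := by
  rw [← sub_le_iff_le_add]
  refine le_min ?_ (le_ciInf fun i => ?_) <;> rw [sub_le_iff_le_add]
  · refine (min_le_left _ _).trans ?_
    linarith [dist_triangle x z y, dist_comm z y]
  · refine (min_le_right _ _).trans ((ciInf_le (potential_bddBelow lo hi x y) i).trans ?_)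
    linarith [pairDist_le_add lo hi y z i]

section Separated

variable {r : ℝ} (hr : 0 ≤ r) (hpair : ∀ i, dist (lo i) (hi i) ≤ r)
  (hsep : ∀ i j, i ≠ j → ∀ p q, (p = lo i ∨ p = hi i) → (q = lo j ∨ q = hi j) → r ≤ dist p q)

include hr hpair hsep

lemma potential_of_mem_pair {i : ι} {p : X} (hp : p = lo i ∨ p = hi i) :
    potential lo hi x p = pairDist lo hi x i := by
  have hzero : pairDist lo hi p i = 0 := by
    refine le_antisymm ?_ (pairDist_nonneg lo hi p i)
    rcases hp with rfl | rfl <;> simp [pairDist]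
  have hle : pairDist lo hi x i ≤ dist x p := by
    rcases hp with rfl | rfl
    exacts [min_le_left _ _, min_le_right _ _]
  refine le_antisymm ?_ (le_min ?_ (le_ciInf fun j => ?_))
  · refine (min_le_right _ _).trans ((ciInf_le (potential_bddBelow lo hi x p) i).trans ?_)
    simp [hzero]
  · linarith [dist_nonneg (x := x) (y := p)]
  · rcases eq_or_ne j i with rfl | hji
    · linarith [pairDist_nonneg lo hi p j]
    obtain ⟨v, hv, hxv⟩ := exists_dist_eq_pairDist (lo := lo) (hi := hi) (x := x) j
    obtain ⟨w, hw, hpw⟩ := exists_dist_eq_pairDist (lo := lo) (hi := hi) (x := p) j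
    have h1 := hsep i j hji.symm p w hp hw
    have h2 := dist_le_of_mem_pair hr (hpair j) hv hw
    linarith [dist_triangle4 x v w p, dist_comm p w]

omit hsep in
lemma dist_le_of_potential_lt {y : X} {R : ℝ} (h : potential lo hi x y < R) :
    dist x y ≤ 2 * R + r := by
  have hR : 0 < R := (potential_nonneg y).trans_lt h
  rcases min_lt_iff.1 h with h | h
  · linarith [dist_nonneg (x := x) (y := y)]
  obtain ⟨i, hi'⟩ := exists_lt_of_ciInf_lt h
  obtain ⟨v, hv, hxv⟩ := exists_dist_eq_pairDist (lo := lo) (hi := hi) (x := x) i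
  obtain ⟨w, hw, hyw⟩ := exists_dist_eq_pairDist (lo := lo) (hi := hi) (x := y) i
  have h2 := dist_le_of_mem_pair hr (hpair i) hv hw
  linarith [dist_triangle4 x v w y, dist_comm y w, pairDist_nonneg lo hi x i,
    pairDist_nonneg lo hi y i]

lemma exists_cover_potential_lt (R : ℝ) :
    ∃ u v : X, ∀ y, potential lo hi x y < R → dist x y ≤ 4 * R ∨ dist u y ≤ 4 * R ∨
      dist v y ≤ 4 * R := by
  rcases lt_or_ge r (2 * R) with hrR | hrR
  · exact ⟨x, x, fun y hy => Or.inl (by linarith [dist_le_of_potential_lt hr hpair hy])⟩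
  by_cases hex : ∃ i, pairDist lo hi x i < R
  · obtain ⟨i, hi'⟩ := hex
    refine ⟨lo i, hi i, fun y hy => ?_⟩
    have hR : 0 < R := (potential_nonneg y).trans_lt hy
    rcases min_lt_iff.1 hy with h | h
    · exact Or.inl (by linarith [dist_nonneg (x := x) (y := y)])
    obtain ⟨j, hj⟩ := exists_lt_of_ciInf_lt h
    have hj1 : pairDist lo hi x j < R := by linarith [pairDist_nonneg lo hi y j]
    have hj2 : pairDist lo hi y j < R := by
      linarith [pairDist_nonneg lo hi x j, pairDist_nonneg lo hi y j]
    obtain rfl : i = j := by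
      by_contra hne
      obtain ⟨p, hp, hxp⟩ := exists_dist_lt_of_pairDist_lt hi'
      obtain ⟨q, hq, hxq⟩ := exists_dist_lt_of_pairDist_lt hj1
      linarith [hsep i j hne p q hp hq, dist_triangle_left p q x]
    obtain ⟨p, hp, hyp⟩ := exists_dist_lt_of_pairDist_lt hj2
    rw [dist_comm] at hyp
    rcases hp with rfl | rfl
    · exact Or.inr (Or.inl (by linarith))
    · exact Or.inr (Or.inr (by linarith))
  · refine ⟨x, x, fun y hy => Or.inl ?_⟩
    have hR : 0 < R := (potential_nonneg y).trans_lt hy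
    rcases min_lt_iff.1 hy with h | h
    · linarith [dist_nonneg (x := x) (y := y)]
    obtain ⟨j, hj⟩ := exists_lt_of_ciInf_lt h
    exact (hex ⟨j, by linarith [pairDist_nonneg lo hi y j]⟩).elim

end Separated

end Potential

section Smoothing

/-- Vertical inf-convolution with `|·| / ρ`. -/
noncomputable def vertSmooth (ρ : ℝ) (f : H → ℝ) (p : H) : ℝ := ⨅ t : ℝ, (f (vert p t) + |t| / ρ)

variable {ρ : ℝ} {f : H → ℝ} (hρ : 0 < ρ) (hf : ∀ p, 0 ≤ f p)

include hρ hf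

lemma vertSmooth_le (p : H) (t : ℝ) : vertSmooth ρ f p ≤ f (vert p t) + |t| / ρ :=
  ciInf_le ⟨0, by rintro _ ⟨t, rfl⟩; have := hf (vert p t); positivity⟩ t

lemma vertSmooth_le_self (p : H) : vertSmooth ρ f p ≤ f p := by
  simpa [vert] using vertSmooth_le hρ hf p 0

lemma vertSmooth_nonneg (p : H) : 0 ≤ vertSmooth ρ f p :=
  le_ciInf fun t => by have := hf (vert p t); positivity

lemma vertSmooth_le_add (hlip : ∀ p q, f p ≤ f q + 2 * dbox p q) (p q : H) :
    vertSmooth ρ f p ≤ vertSmooth ρ f q + 2 * dbox p q := by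
  rw [← sub_le_iff_le_add]
  refine le_ciInf fun t => ?_
  have h1 := vertSmooth_le hρ hf p t
  have h2 := hlip (vert p t) (vert q t)
  rw [dbox_vert_vert] at h2
  linarith

lemma vertSmooth_vert_le (p : H) (s : ℝ) :
    vertSmooth ρ f (vert p s) ≤ vertSmooth ρ f p + |s| / ρ := by
  rw [← sub_le_iff_le_add]
  refine le_ciInf fun t => ?_
  have h1 := vertSmooth_le hρ hf (vert p s) (t - s)
  have h2 : vert (vert p s) (t - s) = vert p t := by simp [vert]
  have h3 : |t - s| / ρ ≤ |t| / ρ + |s| / ρ := by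
    rw [← add_div]; gcongr; exact abs_sub t s
  rw [h2] at h1
  linarith

omit hf in
lemma sub_le_vertSmooth (hlip : ∀ p q, f p ≤ f q + 2 * dbox p q) (p : H) :
    f p - ρ ≤ vertSmooth ρ f p := by
  refine le_ciInf fun t => ?_
  have h1 := hlip p (vert p t)
  rw [dbox_vert_self] at h1
  have h2 : 2 * Real.sqrt |t| ≤ ρ + |t| / ρ := by
    have h3 : |t| = Real.sqrt |t| ^ 2 := (Real.sq_sqrt (abs_nonneg t)).symm
    rw [← sub_nonneg]
    have : ρ + |t| / ρ - 2 * Real.sqrt |t| = (Real.sqrt |t| - ρ) ^ 2 / ρ := by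
      nth_rewrite 1 [h3]; field_simp; ring
    rw [this]; positivity
  linarith

end Smoothing

section Scales

/-- The shortening factor at level `k`; each value `1 / (m + 1)` is taken at infinitely many
levels. -/
noncomputable def shrink (k : ℕ) : ℝ := 1 / ((Nat.unpair k).1 + 1)

/-- The distance between the two points of a pair of level `k`. -/
noncomputable def gap (k : ℕ) : ℝ := 1 / ((k + 1).factorial : ℝ) ^ 2

/-- The length of the shortcuts of level `k`. -/
noncomputable def cost (k : ℕ) : ℝ := shrink k * gap k

lemma shrink_pos (k : ℕ) : 0 < shrink k := by unfold shrink; positivity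

lemma shrink_le_one (k : ℕ) : shrink k ≤ 1 := by
  unfold shrink
  rw [div_le_one (by positivity)]
  have : (0 : ℝ) ≤ (Nat.unpair k).1 := by positivity
  linarith

lemma le_shrink (k : ℕ) : 1 / ((k : ℝ) + 1) ≤ shrink k := by
  unfold shrink
  gcongr
  exact Nat.unpair_left_le k

lemma gap_pos (k : ℕ) : 0 < gap k := by unfold gap; positivity

lemma cost_pos (k : ℕ) : 0 < cost k := mul_pos (shrink_pos k) (gap_pos k)

lemma cost_le_gap (k : ℕ) : cost k ≤ gap k :=
  mul_le_of_le_one_left (gap_pos k).le (shrink_le_one k)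

lemma gap_le_shrink_mul_cost {k j : ℕ} (h : k < j) : gap j ≤ shrink j * cost k := by
  have h1 : ((j : ℝ) + 1) * (k + 1).factorial ≤ (j + 1).factorial := by
    have := Nat.mul_le_mul_left (j + 1) (Nat.factorial_le (Nat.succ_le_of_lt h))
    rw [← Nat.factorial_succ] at this
    exact_mod_cast this
  have hk : (k : ℝ) + 1 ≤ j + 1 := by exact_mod_cast Nat.succ_le_succ h.le
  calc gap j ≤ 1 / (((j : ℝ) + 1) * (k + 1).factorial) ^ 2 := by unfold gap; gcongr
    _ = 1 / ((j : ℝ) + 1) * (1 / ((j : ℝ) + 1) * gap k) := by unfold gap; field_simp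
    _ ≤ shrink j * (shrink k * gap k) := by
        have hg := (gap_pos k).le
        have hj := (shrink_pos j).le
        gcongr
        · exact le_shrink j
        · exact (one_div_le_one_div_of_le (by positivity) hk).trans (le_shrink k)

lemma cost_antitone : Antitone cost := by
  intro k j h
  rcases h.eq_or_lt with rfl | h
  · exact le_rfl
  calc cost j ≤ gap j := cost_le_gap j
    _ ≤ shrink j * cost k := gap_le_shrink_mul_cost h
    _ ≤ cost k := mul_le_of_le_one_left (cost_pos k).le (shrink_le_one j)

lemma gap_le (k : ℕ) : gap k ≤ 1 / ((k : ℝ) + 1) := by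
  unfold gap
  refine one_div_le_one_div_of_le (by positivity) ?_
  have h1 : (k + 1) ≤ (k + 1).factorial ^ 2 :=
    (Nat.self_le_factorial _).trans (Nat.le_self_pow two_ne_zero _)
  exact_mod_cast h1

lemma tendsto_gap : Filter.Tendsto gap Filter.atTop (nhds 0) :=
  squeeze_zero (fun k => (gap_pos k).le) gap_le tendsto_one_div_add_atTop_nhds_zero_nat

lemma tendsto_cost : Filter.Tendsto cost Filter.atTop (nhds 0) :=
  squeeze_zero (fun k => (cost_pos k).le) cost_le_gap tendsto_gap

lemma exists_level {R : ℝ} (hR : 0 < R) : ∃ k, 2 * cost k ≤ R ∧ ∀ j < k, R ≤ 2 * cost j := by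
  have hex : ∃ k, 2 * cost k ≤ R := by
    obtain ⟨k, hk⟩ := (tendsto_cost.eventually (gt_mem_nhds (half_pos hR))).exists
    exact ⟨k, by linarith⟩
  classical
  exact ⟨Nat.find hex, Nat.find_spec hex, fun j hj => (not_le.1 (Nat.find_min hex hj)).le⟩

end Scales

section Lattice

/-- The dilation by `r` of the integer lattice. -/
def latticePt (r : ℝ) (i : ℤ × ℤ × ℤ) : H := (r * i.1, r * i.2.1, r ^ 2 * i.2.2)

/-- The lower points of the pairs at scale `r`. -/
def pairLo (r : ℝ) (i : ℤ × ℤ × ℤ) : H := latticePt r (i.1, i.2.1, 2 * i.2.2)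

/-- The upper points of the pairs at scale `r`. -/
def pairHi (r : ℝ) (i : ℤ × ℤ × ℤ) : H := latticePt r (i.1, i.2.1, 2 * i.2.2 + 1)

lemma pairHi_eq_vert (r : ℝ) (i : ℤ × ℤ × ℤ) : pairHi r i = vert (pairLo r i) (r ^ 2) := by
  unfold pairHi pairLo vert latticePt
  ext <;> push_cast <;> ring

lemma int_eq_of_abs_mul_sub_lt {r : ℝ} (hr : 0 < r) {a b : ℤ} (h : |r * b - r * a| < r) :
    a = b := by
  rw [← mul_sub, abs_mul, abs_of_pos hr] at h
  have h1 : |(b : ℝ) - a| < 1 := by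
    by_contra! h2
    nlinarith
  have h2 : |b - a| < 1 := by exact_mod_cast h1
  linarith [Int.abs_lt_one_iff.1 h2]

lemma le_dbox_latticePt {r : ℝ} (hr : 0 < r) {i j : ℤ × ℤ × ℤ} (hij : i ≠ j) :
    r ≤ dbox (latticePt r i) (latticePt r j) := by
  by_contra! h
  rw [dbox_eq, max_lt_iff, max_lt_iff, Real.sqrt_lt' hr] at h
  obtain ⟨h1, h2, h3⟩ := h
  have e1 := int_eq_of_abs_mul_sub_lt hr h1
  have e2 := int_eq_of_abs_mul_sub_lt hr h2
  have e4 : vgap (latticePt r i) (latticePt r j) = r ^ 2 * j.2.2 - r ^ 2 * i.2.2 := by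
    simp only [vgap, latticePt, e1, e2]; ring
  rw [e4] at h3
  exact hij (Prod.ext e1 (Prod.ext e2 (int_eq_of_abs_mul_sub_lt (by positivity) h3)))

lemma dbox_pairLo_pairHi {r : ℝ} (hr : 0 ≤ r) (i : ℤ × ℤ × ℤ) :
    dbox (pairLo r i) (pairHi r i) = r := by
  rw [pairHi_eq_vert, dbox_vert_self, abs_of_nonneg (by positivity), Real.sqrt_sq hr]

lemma pair_separated {r : ℝ} (hr : 0 < r) (i j : ℤ × ℤ × ℤ) (hij : i ≠ j) (p q : H)
    (hp : p = pairLo r i ∨ p = pairHi r i) (hq : q = pairLo r j ∨ q = pairHi r j) :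
    r ≤ dbox p q := by
  have hne : i.1 = j.1 → i.2.1 = j.2.1 → i.2.2 ≠ j.2.2 := fun h1 h2 h3 =>
    hij (Prod.ext h1 (Prod.ext h2 h3))
  rcases hp with rfl | rfl <;> rcases hq with rfl | rfl <;>
    refine le_dbox_latticePt hr fun h => ?_ <;>
    simp only [Prod.mk.injEq] at h <;>
    exact hne h.1 h.2.1 (by omega)

lemma exists_pairLo_near {r : ℝ} (hr : 0 < r) (p : H) :
    ∃ i, dbox (pairLo r i) p ≤ 2 * r := by
  have hfloor : ∀ (s t : ℝ), 0 < s → |t - s * ⌊t / s⌋| ≤ s := by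
    intro s t hs
    have e : t - s * ⌊t / s⌋ = s * Int.fract (t / s) := by
      rw [Int.fract]; field_simp
    rw [e, abs_of_nonneg (mul_nonneg hs.le (Int.fract_nonneg _))]
    exact mul_le_of_le_one_right hs.le (Int.fract_lt_one _).le
  set a := ⌊p.1 / r⌋ with ha
  set b := ⌊p.2.1 / r⌋ with hb
  set w := p.2.2 + (r * b * p.1 - r * a * p.2.1) / 2 with hw
  refine ⟨(a, b, ⌊w / (2 * r ^ 2)⌋), ?_⟩
  rw [dbox_le_iff (by positivity)]
  refine ⟨(hfloor r p.1 hr).trans (by linarith), (hfloor r p.2.1 hr).trans (by linarith), ?_⟩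
  have e : vgap (pairLo r (a, b, ⌊w / (2 * r ^ 2)⌋)) p = w - 2 * r ^ 2 * ⌊w / (2 * r ^ 2)⌋ := by
    simp only [vgap, pairLo, latticePt]; push_cast; rw [hw]; ring
  rw [e]
  exact (hfloor (2 * r ^ 2) w (by positivity)).trans (by nlinarith)

end Lattice

section ShortcutDistance

/-- The functions that are `1`-Lipschitz for the box distance and vary by at most `cost k` over the
pairs of level `k`. -/
def IsAdmissible (f : H → ℝ) : Prop :=
  (∀ p q, |f p - f q| ≤ dbox p q) ∧
    ∀ k i, |f (pairLo (gap k) i) - f (pairHi (gap k) i)| ≤ cost k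

/-- The largest pseudodistance below `dbox` for which the two points of a pair of level `k` are at
distance at most `cost k`. -/
noncomputable def shortcutDist (p q : H) : ℝ := ⨆ f : {f // IsAdmissible f}, |f.1 p - f.1 q|

lemma isAdmissible_zero : IsAdmissible 0 := by
  constructor
  · intro p q
    simpa using dbox_nonneg p q
  · intro k i
    simpa using (cost_pos k).le

instance : Nonempty {f // IsAdmissible f} := ⟨⟨0, isAdmissible_zero⟩⟩

lemma IsAdmissible.le_shortcutDist {f : H → ℝ} (hf : IsAdmissible f) (p q : H) :
    |f p - f q| ≤ shortcutDist p q :=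
  le_ciSup (f := fun f : {f // IsAdmissible f} => |f.1 p - f.1 q|)
    ⟨dbox p q, by rintro _ ⟨f, rfl⟩; exact f.2.1 p q⟩ ⟨f, hf⟩

lemma shortcutDist_le_dbox (p q : H) : shortcutDist p q ≤ dbox p q :=
  ciSup_le fun f => f.2.1 p q

lemma shortcutDist_pair_le (k : ℕ) (i : ℤ × ℤ × ℤ) :
    shortcutDist (pairLo (gap k) i) (pairHi (gap k) i) ≤ cost k :=
  ciSup_le fun f => f.2.2 k i

lemma shortcutDist_comm (p q : H) : shortcutDist p q = shortcutDist q p := by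
  simp only [shortcutDist, abs_sub_comm]

lemma shortcutDist_self (p : H) : shortcutDist p p = 0 := by
  simp [shortcutDist]

lemma shortcutDist_triangle (p q s : H) :
    shortcutDist p s ≤ shortcutDist p q + shortcutDist q s :=
  ciSup_le fun f => (abs_sub_le _ (f.1 q) _).trans
    (add_le_add (f.2.le_shortcutDist p q) (f.2.le_shortcutDist q s))

/-- The potential of level `k` based at `x`. -/
noncomputable def levelPotential (k : ℕ) (x y : H) : ℝ :=
  potential (X := BoxSpace) (pairLo (gap k)) (pairHi (gap k)) x y

lemma levelPotential_nonneg (k : ℕ) (x y : H) : 0 ≤ levelPotential k x y :=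
  potential_nonneg (X := BoxSpace) y

lemma levelPotential_self (k : ℕ) (x : H) : levelPotential k x x = 0 :=
  potential_self (X := BoxSpace)

lemma levelPotential_le_add (k : ℕ) (x y z : H) :
    levelPotential k x y ≤ levelPotential k x z + 2 * dbox y z :=
  potential_le_add (X := BoxSpace) y z

lemma levelPotential_pairLo_eq_pairHi (k : ℕ) (x : H) (i : ℤ × ℤ × ℤ) :
    levelPotential k x (pairLo (gap k) i) = levelPotential k x (pairHi (gap k) i) :=
  have h := fun {p} => potential_of_mem_pair (X := BoxSpace) (lo := pairLo (gap k))
    (hi := pairHi (gap k)) (x := x) (p := p) (i := i) (gap_pos k).le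
    (fun i => (dbox_pairLo_pairHi (gap_pos k).le i).le) (pair_separated (gap_pos k))
  (h (Or.inl rfl)).trans (h (Or.inr rfl)).symm

lemma dbox_le_of_levelPotential_lt {k : ℕ} {x y : H} {R : ℝ} (h : levelPotential k x y < R) :
    dbox x y ≤ 2 * R + gap k :=
  dist_le_of_potential_lt (X := BoxSpace) (gap_pos k).le
    (fun i => (dbox_pairLo_pairHi (gap_pos k).le i).le) h

lemma exists_cover_levelPotential_lt (k : ℕ) (x : H) (R : ℝ) :
    ∃ u v : H, ∀ y, levelPotential k x y < R → dbox x y ≤ 4 * R ∨ dbox u y ≤ 4 * R ∨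
      dbox v y ≤ 4 * R :=
  exists_cover_potential_lt (X := BoxSpace) (gap_pos k).le
    (fun i => (dbox_pairLo_pairHi (gap_pos k).le i).le) (pair_separated (gap_pos k)) R

lemma exists_isAdmissible {k : ℕ} {R : ℝ} (hk : 2 * cost k ≤ R) (hj : ∀ j < k, R ≤ 2 * cost j)
    (x : H) : ∃ f, IsAdmissible f ∧ f x = 0 ∧ ∀ y, R ≤ levelPotential k x y → R / 4 ≤ f y := by
  have hc := cost_pos k
  have hR : 0 < R := by linarith
  set g : H → ℝ := fun y => min (levelPotential k x y) R with hg
  have hg0 : ∀ y, 0 ≤ g y := fun y => le_min (levelPotential_nonneg k x y) hR.le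
  have hglip : ∀ p q, g p ≤ g q + 2 * dbox p q := by
    intro p q
    have h1 : levelPotential k x p ≤ levelPotential k x q + 2 * dbox p q :=
      levelPotential_le_add k x p q
    rw [hg, ← min_add_add_right]
    exact min_le_min h1 (by linarith [dbox_nonneg p q])
  set s := vertSmooth (cost k) g with hs
  have hs0 := vertSmooth_nonneg hc hg0
  have hsg := vertSmooth_le_self hc hg0
  have hgs := sub_le_vertSmooth hc hglip
  have hsR : ∀ y, s y ≤ R := fun y => (hsg y).trans (min_le_right _ _)
  refine ⟨fun y => s y / 2, ⟨fun p q => ?_, fun j i => ?_⟩, ?_, fun y hy => ?_⟩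
  · have h1 := vertSmooth_le_add hc hg0 hglip p q
    have h2 := vertSmooth_le_add hc hg0 hglip q p
    rw [dbox_comm q p] at h2
    rw [abs_le]; constructor <;> linarith
  · have h1 := hs0 (pairLo (gap j) i)
    have h2 := hs0 (pairHi (gap j) i)
    have h3 := hsR (pairLo (gap j) i)
    have h4 := hsR (pairHi (gap j) i)
    have hcj := cost_pos j
    rcases lt_trichotomy j k with hjk | rfl | hjk
    · have := hj j hjk
      rw [abs_le]; constructor <;> linarith
    · have e : g (pairLo (gap j) i) = g (pairHi (gap j) i) := by
        simp only [hg, levelPotential_pairLo_eq_pairHi]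
      have h5 := hsg (pairLo (gap j) i)
      have h6 := hsg (pairHi (gap j) i)
      have h7 := hgs (pairLo (gap j) i)
      have h8 := hgs (pairHi (gap j) i)
      rw [abs_le]; constructor <;> linarith
    · have h5 : |gap j ^ 2| / cost k ≤ cost j := by
        rw [abs_of_nonneg (by positivity), div_le_iff₀ hc, cost]
        nlinarith [gap_le_shrink_mul_cost hjk, gap_pos j]
      have h6 := vertSmooth_vert_le hc hg0 (pairLo (gap j) i) (gap j ^ 2)
      have h7 := vertSmooth_vert_le hc hg0 (pairHi (gap j) i) (-gap j ^ 2)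
      have h8 : vert (pairHi (gap j) i) (-gap j ^ 2) = pairLo (gap j) i := by
        rw [pairHi_eq_vert]; simp [vert]
      rw [h8, abs_neg] at h7
      rw [← pairHi_eq_vert] at h6
      rw [abs_le]; constructor <;> linarith
  · have h1 : g x = 0 := by
      simp only [hg, levelPotential_self, hR.le, min_eq_left]
    have h2 : s x = 0 := le_antisymm ((hsg x).trans_eq h1) (hs0 x)
    simp [h2]
  · have h1 : g y = R := min_eq_right hy
    have h2 := hgs y
    change R / 4 ≤ s y / 2
    linarith

lemma levelPotential_lt {k : ℕ} {R : ℝ} (hk : 2 * cost k ≤ R) (hj : ∀ j < k, R ≤ 2 * cost j)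
    {x y : H} (h : shortcutDist x y < R / 4) : levelPotential k x y < R := by
  obtain ⟨f, hf, hfx, hfy⟩ := exists_isAdmissible hk hj x
  by_contra! hR
  have h1 := hf.le_shortcutDist x y
  rw [hfx, zero_sub, abs_neg] at h1
  linarith [hfy y hR, le_abs_self (f y)]

lemma eq_of_shortcutDist_eq_zero {x y : H} (h : shortcutDist x y = 0) : x = y := by
  refine eq_of_dbox_eq_zero (le_antisymm ?_ (dbox_nonneg x y))
  have hle : ∀ k, dbox x y ≤ 5 * gap k := by
    intro k
    have h1 : levelPotential k x y < 2 * cost k := levelPotential_lt le_rfl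
      (fun j hj => by linarith [cost_antitone hj.le]) (by rw [h]; linarith [cost_pos k])
    linarith [dbox_le_of_levelPotential_lt h1, cost_le_gap k]
  have := ge_of_tendsto' (tendsto_gap.const_mul 5) hle
  simpa using this

lemma volume_shortcutDist_lt (x : H) {R : ℝ} (hR : 0 < R) :
    volume {y | shortcutDist x y < R} ≤ ENNReal.ofReal (24 * 16 ^ 4 * R ^ 4) := by
  obtain ⟨k, hk, hj⟩ := exists_level (R := 4 * R) (by positivity)
  obtain ⟨u, v, huv⟩ := exists_cover_levelPotential_lt k x (4 * R)
  have hsub : {y | shortcutDist x y < R} ⊆ {y | dbox x y ≤ 16 * R} ∪ {y | dbox u y ≤ 16 * R} ∪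
      {y | dbox v y ≤ 16 * R} := by
    intro y hy
    have h1 : levelPotential k x y < 4 * R :=
      levelPotential_lt hk hj (lt_of_lt_of_eq hy (by ring))
    have h2 := huv y h1
    simp only [← mul_assoc] at h2
    norm_num at h2
    rcases h2 with h2 | h2 | h2
    exacts [Or.inl (Or.inl h2), Or.inl (Or.inr h2), Or.inr h2]
  refine (measure_mono hsub).trans ((measure_union_le _ _).trans
    ((add_le_add_left (measure_union_le _ _) _).trans ?_))
  rw [volume_dbox_closedBall _ (by positivity), volume_dbox_closedBall _ (by positivity),
    volume_dbox_closedBall _ (by positivity), ← ENNReal.ofReal_add (by positivity) (by positivity),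
    ← ENNReal.ofReal_add (by positivity) (by positivity)]
  exact ENNReal.ofReal_le_ofReal (le_of_eq (by ring))

lemma volume_shortcutDist_le (x : H) {D : ℝ} (hD : 0 ≤ D) :
    volume {y | shortcutDist x y ≤ D} ≤ ENNReal.ofReal (24 * 16 ^ 4 * D ^ 4) := by
  have hc : Filter.Tendsto (fun R : ℝ => ENNReal.ofReal (24 * 16 ^ 4 * R ^ 4))
      (nhdsWithin D (Set.Ioi D)) (nhds (ENNReal.ofReal (24 * 16 ^ 4 * D ^ 4))) :=
    (Continuous.tendsto (ENNReal.continuous_ofReal.comp (by fun_prop)) D).mono_left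
      nhdsWithin_le_nhds
  refine ge_of_tendsto hc (Filter.eventually_of_mem self_mem_nhdsWithin fun R hR => ?_)
  have hsub : {y | shortcutDist x y ≤ D} ⊆ {y | shortcutDist x y < R} := by
    intro y hy
    have hy' : shortcutDist x y ≤ D := hy
    have hR' : D < R := hR
    exact hy'.trans_lt hR'
  exact (measure_mono hsub).trans (volume_shortcutDist_lt x (hD.trans_lt hR))

lemma isDistance_shortcutDist : IsDistance shortcutDist :=
  ⟨shortcutDist_comm, shortcutDist_self, fun _ _ => eq_of_shortcutDist_eq_zero,
    shortcutDist_triangle⟩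

lemma ahlforsRegularOf_shortcutDist : AhlforsRegularOf shortcutDist 4 := by
  refine ⟨1250 * (24 * 16 ^ 4), by norm_num, fun x r hr _ => ⟨?_, ?_⟩⟩
  · have h1 := volume_le_hausdorffOf (by norm_num)
      (fun x D hD => volume_shortcutDist_le x hD) (ballOf shortcutDist x r)
    have h2 : {y | dbox x y ≤ r / 2} ⊆ ballOf shortcutDist x r := fun y hy =>
      (shortcutDist_le_dbox x y).trans_lt (lt_of_le_of_lt hy (half_lt_self hr))
    have h3 := (measure_mono h2).trans h1
    rw [volume_dbox_closedBall x (by positivity), mul_comm,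
      mul_comm (ENNReal.ofReal (24 * 16 ^ 4)),
      ← ENNReal.div_le_iff_le_mul (Or.inl (by norm_num)) (Or.inl ENNReal.ofReal_ne_top),
      ← ENNReal.ofReal_div_of_pos (by norm_num)] at h3
    refine le_trans (ENNReal.ofReal_le_ofReal ?_) h3
    rw [show (4 : ℝ) = (4 : ℕ) by norm_num, Real.rpow_natCast]
    have : 0 < r ^ 4 := by positivity
    norm_num
    linarith
  · calc hausdorffOf shortcutDist 4 (ballOf shortcutDist x r)
        ≤ hausdorffOf dbox 4 (ballOf shortcutDist x r) :=
          hausdorffOf_mono_dist shortcutDist_le_dbox (by norm_num) _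
      _ ≤ 1250 * volume (ballOf shortcutDist x r) := hausdorffOf_dbox_le_volume _
      _ ≤ 1250 * ENNReal.ofReal (24 * 16 ^ 4 * r ^ 4) := by
          gcongr
          exact volume_shortcutDist_lt x hr
      _ = _ := by
          rw [← ENNReal.ofReal_ofNat 1250, ← ENNReal.ofReal_mul (by norm_num)]
          congr 1
          rw [show (4 : ℝ) = (4 : ℕ) by norm_num, Real.rpow_natCast]
          ring

end ShortcutDistance

open Filter Topology in
/-- A set with holes of relative size `c` at every point, along a sequence of scales tending to
zero, is null. -/
lemma BoxSpace.volume_eq_zero_of_holes {A : Set BoxSpace} {δ : ℕ → ℝ} {c : ℝ}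
    (hδ : Tendsto δ atTop (𝓝[>] 0)) (hδ0 : ∀ n, 0 < δ n) (hc : 0 < c)
    (h : ∀ x n, ∃ w, Metric.closedBall w (c * δ n) ⊆ Metric.closedBall x (δ n) \ A) :
    volume A = 0 := by
  by_contra hA
  have hne : volume.restrict A ≠ 0 := by rwa [Ne, Measure.restrict_eq_zero]
  have : (ae (volume.restrict A)).NeBot := ae_neBot.2 hne
  obtain ⟨x, hx⟩ := (IsUnifLocDoublingMeasure.ae_tendsto_measure_inter_div
    (volume : Measure BoxSpace) A 1).exists
  have hlim := hx (fun _ => x) δ hδ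
    (Eventually.of_forall fun n => Metric.mem_closedBall_self (by simpa using (hδ0 n).le))
  have hbound : ∀ n, volume (A ∩ Metric.closedBall x (δ n)) / volume (Metric.closedBall x (δ n)) ≤
      ENNReal.ofReal (1 - c ^ 4) := by
    intro n
    obtain ⟨w, hw⟩ := h x n
    have hcδ : 0 ≤ c * δ n := (mul_pos hc (hδ0 n)).le
    have hδ4 : 0 < 8 * δ n ^ 4 := by have := hδ0 n; positivity
    have hsub : A ∩ Metric.closedBall x (δ n) ⊆
        Metric.closedBall x (δ n) \ Metric.closedBall w (c * δ n) :=
      fun y hy => ⟨hy.2, fun hyw => (hw hyw).2 hy.1⟩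
    have hle := measure_mono (μ := volume) hsub
    rw [measure_sdiff (hw.trans Set.sdiff_subset)
      Metric.isClosed_closedBall.measurableSet.nullMeasurableSet
      (by rw [BoxSpace.volume_closedBall w hcδ]; exact ENNReal.ofReal_ne_top),
      BoxSpace.volume_closedBall w hcδ, BoxSpace.volume_closedBall x (hδ0 n).le,
      ← ENNReal.ofReal_sub _ (by positivity)] at hle
    rw [BoxSpace.volume_closedBall x (hδ0 n).le]
    refine ENNReal.div_le_of_le_mul (hle.trans_eq ?_)
    rw [← ENNReal.ofReal_mul' hδ4.le]
    congr 1
    ring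
  have h1 : (1 : ℝ≥0∞) ≤ ENNReal.ofReal (1 - c ^ 4) := le_of_tendsto' hlim hbound
  rw [ENNReal.one_le_ofReal] at h1
  have : 0 < c ^ 4 := by positivity
  linarith

open Filter Topology in
lemma tendsto_gap_pair (m : ℕ) : Tendsto (fun n => 5 * gap (Nat.pair m n)) atTop (𝓝[>] 0) := by
  refine tendsto_nhdsWithin_iff.2 ⟨?_, Eventually.of_forall fun n => ?_⟩
  · have hpair : Tendsto (fun n => Nat.pair m n) atTop atTop :=
      tendsto_atTop_mono (Nat.right_le_pair m) tendsto_id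
    simpa using (tendsto_gap.comp hpair).const_mul 5
  · exact mul_pos (by norm_num) (gap_pos _)

lemma shortcutDist_lt_of_near_pair {k : ℕ} {i : ℤ × ℤ × ℤ} {u v : H} {L : ℝ} (hL : 1 ≤ L)
    (hk : 6 * shrink k * L < 1) (hu : dbox (pairLo (gap k) i) u ≤ shrink k * gap k)
    (hv : dbox (pairHi (gap k) i) v ≤ shrink k * gap k) :
    shortcutDist u v < L⁻¹ * dbox u v := by
  have hg := gap_pos k
  have hs := shrink_pos k
  have hL0 : 0 < L := by linarith
  have hs6 : 6 * shrink k < 1 := by nlinarith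
  have hpair := dbox_pairLo_pairHi hg.le i
  have hd : gap k / 2 ≤ dbox u v := by
    have h1 := dbox_triangle (pairLo (gap k) i) u (pairHi (gap k) i)
    have h2 := dbox_triangle u v (pairHi (gap k) i)
    rw [dbox_comm v] at h2
    nlinarith
  have hsc : shortcutDist u v ≤ 3 * (shrink k * gap k) := by
    have h1 := shortcutDist_triangle u (pairLo (gap k) i) v
    have h2 := shortcutDist_triangle (pairLo (gap k) i) (pairHi (gap k) i) v
    have h3 : shortcutDist (pairLo (gap k) i) (pairHi (gap k) i) ≤ shrink k * gap k :=
      shortcutDist_pair_le k i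
    have h4 := shortcutDist_le_dbox (pairLo (gap k) i) u
    have h5 := shortcutDist_le_dbox (pairHi (gap k) i) v
    rw [shortcutDist_comm u (pairLo (gap k) i)] at h1
    linarith
  rw [inv_mul_eq_div, lt_div_iff₀ hL0]
  have h6 : shortcutDist u v * L ≤ 3 * (shrink k * gap k) * L :=
    mul_le_mul_of_nonneg_right hsc hL0.le
  nlinarith

lemma exists_hole_of_biLipOn {A : Set H} {L : ℝ} (hL : 1 ≤ L)
    (hA : ∀ x ∈ A, ∀ y ∈ A, L⁻¹ * dbox x y ≤ shortcutDist x y) {k : ℕ}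
    (hk : 6 * shrink k * L < 1) (x : H) :
    ∃ w, dbox x w ≤ 3 * gap k ∧ ∀ y ∈ A, ¬ dbox w y ≤ shrink k * gap k := by
  have hg := gap_pos k
  obtain ⟨i, hi⟩ := exists_pairLo_near hg x
  rw [dbox_comm] at hi
  by_cases hlo : ∀ y ∈ A, ¬ dbox (pairLo (gap k) i) y ≤ shrink k * gap k
  · exact ⟨_, hi.trans (by linarith), hlo⟩
  push Not at hlo
  obtain ⟨u, huA, hu⟩ := hlo
  refine ⟨pairHi (gap k) i, ?_, fun v hvA hv =>
    (shortcutDist_lt_of_near_pair hL hk hu hv).not_ge (hA u huA v hvA)⟩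
  have h1 := dbox_triangle x (pairLo (gap k) i) (pairHi (gap k) i)
  rw [dbox_pairLo_pairHi hg.le i] at h1
  linarith

lemma volume_eq_zero_of_biLipOn {A : Set H} (hA : BiLipOn shortcutDist dbox A) :
    volume A = 0 := by
  obtain ⟨L, hL, h⟩ := hA
  have hL0 : 0 < L := by linarith
  obtain ⟨m, hm⟩ := exists_nat_gt (6 * L)
  have hm0 : (0 : ℝ) < m + 1 := by positivity
  have hshrink : ∀ n, shrink (Nat.pair m n) = 1 / (m + 1) := fun n => by
    rw [shrink, Nat.unpair_pair]
  have hsmall : ∀ n, 6 * shrink (Nat.pair m n) * L < 1 := fun n => by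
    rw [hshrink, mul_one_div, div_mul_eq_mul_div, div_lt_one hm0]
    linarith
  refine BoxSpace.volume_eq_zero_of_holes (A := A) (c := 1 / (m + 1) / 5) (tendsto_gap_pair m)
    (fun n => mul_pos (by norm_num) (gap_pos _)) (by positivity) fun x n => ?_
  obtain ⟨w, hxw, hw⟩ := exists_hole_of_biLipOn hL (fun a ha b hb => (h a ha b hb).1) (hsmall n) x
  have hr : 1 / ((m : ℝ) + 1) / 5 * (5 * gap (Nat.pair m n)) =
      shrink (Nat.pair m n) * gap (Nat.pair m n) := by
    rw [hshrink]; ring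
  rw [hr]
  refine ⟨w, fun y hy => ?_⟩
  have hy' : dbox w y ≤ shrink (Nat.pair m n) * gap (Nat.pair m n) :=
    BoxSpace.mem_closedBall.1 hy
  refine ⟨BoxSpace.mem_closedBall.2 ?_, fun hyA => hw y hyA hy'⟩
  have h1 := dbox_triangle x w y
  have h2 := mul_le_mul_of_nonneg_right (shrink_le_one (Nat.pair m n)) (gap_pos (Nat.pair m n)).le
  have h3 := gap_pos (Nat.pair m n)
  linarith

lemma not_biLipOn_shortcutDist {A : Set H} (hA : 0 < hausdorffOf dbox 4 A) :
    ¬ BiLipOn shortcutDist dbox A := fun h => by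
  have := hausdorffOf_dbox_le_volume A
  rw [volume_eq_zero_of_biLipOn h, mul_zero] at this
  exact hA.not_ge this

/-- Theorem 1.2. There exists a distance `d` on the Heisenberg group such
that `d ≤ d_b`, `(ℍ, d)` is Ahlfors 4-regular, and `d`, `d_b` are not biLipschitz equivalent
on any set of positive `H⁴_{d_b}`-measure. -/
theorem statement0 :
    ∃ d : H → H → ℝ, IsDistance d ∧
      (∀ p q : H, d p q ≤ dbox p q) ∧
      AhlforsRegularOf d 4 ∧
      ∀ A : Set H, 0 < hausdorffOf dbox 4 A → ¬ BiLipOn d dbox A :=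
  ⟨shortcutDist, isDistance_shortcutDist, shortcutDist_le_dbox, ahlforsRegularOf_shortcutDist,
    fun _ hA => not_biLipOn_shortcutDist hA⟩

end Heis
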